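/- Let W be a graphon (measurable, symmetric, nonnegative, W ∈ L¹((0,1)²), with degree d_W(x) = ∫₀¹ W(x,y) dy ≤ 1 for a.e. x), and let Φ : ℝ → ℝ satisfy Φ(0) = 0, be locally Lipschitz continuous, and suppose there exist constants M₁ < M₂ with Φ(M₂) ≤ 0 ≤ Φ(M₁). Then for every u₀ ∈ L^∞((0,1)) with M₁ ≤ u₀(x) ≤ M₂ for a.e. x, and for every T > 0, the graphon reaction–diffusion equation ∂u/∂t = ℒ^W u + Φ(u) with initial condition u(·,0) = u₀ has a unique classical solution u ∈ C¹([0,T]; L^∞((0,1))). -/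

import Mathlib

open MeasureTheory Set ENNReal

/-- Lebesgue measure restricted to the interval (0,1). -/
noncomputable def mu01 : Measure ℝ := volume.restrict (Set.Ioo 0 1)

/-- A graphon: a measurable, symmetric, nonnegative kernel in L^1((0,1)^2)
whose degree function is bounded by 1 a.e. -/
def IsGraphon (W : ℝ → ℝ → ℝ) : Prop :=
  Measurable (Function.uncurry W) ∧
  (∀ x y, W x y = W y x) ∧
  (∀ x y, 0 ≤ W x y) ∧
  Integrable (Function.uncurry W) (mu01.prod mu01) ∧
  (∀ᵐ x ∂mu01, (∫ y, W x y ∂mu01) ≤ 1)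

/-- The graphon diffusion operator (graphon Laplacian)
`ℒ^W u (x) = ∫₀¹ W x y (u y - u x) dy`. -/
noncomputable def graphonLap (W : ℝ → ℝ → ℝ) (u : ℝ → ℝ) : ℝ → ℝ :=
  fun x => ∫ y, W x y * (u y - u x) ∂mu01

theorem ode_ball {E : Type*} [NormedAddCommGroup E] [NormedSpace ℝ E] [CompleteSpace E]
    (F P : E → E) (c : E) (r l : ℝ) (hr : 0 ≤ r) (hl : 0 < l) (K : NNReal)
    (hP : LipschitzWith 1 P) (hPm : ∀ f, P f ∈ Metric.closedBall c r)
    (hPid : ∀ f ∈ Metric.closedBall c r, P f = f)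
    (hF : LipschitzOnWith K F (Metric.closedBall c r))
    (hG : ∀ f ∈ Metric.closedBall c r, ‖l • (f - c) + F f‖ ≤ l * r)
    (u₀ : E) (hu₀ : u₀ ∈ Metric.closedBall c r) (T : ℝ) (hT : 0 < T) :
    ∃ u : ℝ → E, u 0 = u₀ ∧
      ∀ t ∈ Icc (0:ℝ) T, HasDerivWithinAt u (F (u t)) (Icc 0 T) t := by
  have hFP : LipschitzWith K (fun z => F (P z)) := by
    refine LipschitzWith.of_dist_le_mul fun x y => ?_
    refine (hF.dist_le_mul _ (hPm x) _ (hPm y)).trans ?_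
    have := hP.dist_le_mul x y
    simp only [NNReal.coe_one, one_mul] at this
    gcongr
  set H : E → E := fun z => l • (P z - c) + F (P z) with hH
  have hHlip : ∀ x y, ‖H x - H y‖ ≤ (l + K) * ‖x - y‖ := by
    intro x y
    have h1 := hP.dist_le_mul x y
    have h2 := hFP.dist_le_mul x y
    simp only [NNReal.coe_one, one_mul, dist_eq_norm] at h1 h2
    have : H x - H y = l • (P x - P y) + (F (P x) - F (P y)) := by
      simp only [hH]; module
    rw [this]
    refine (norm_add_le _ _).trans ?_
    rw [norm_smul, Real.norm_of_nonneg hl.le, add_mul]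
    gcongr
  have hHb : ∀ x, ‖H x‖ ≤ l * r := fun x => hG _ (hPm x)
  have hHc : Continuous H := by
    refine ((hP.continuous.sub continuous_const).const_smul l).add hFP.continuous
  set v : ℝ → E → E := fun t w => Real.exp (l * t) • H (c + Real.exp (-(l * t)) • w) with hv
  have hvb : ∀ t w, ‖v t w‖ ≤ Real.exp (l * t) * (l * r) := by
    intro t w
    simp only [hv, norm_smul, Real.norm_of_nonneg (Real.exp_pos _).le]
    gcongr
    exact hHb _
  have hee : ∀ t, Real.exp (l * t) * Real.exp (-(l * t)) = 1 := fun t => by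
    rw [← Real.exp_add]; simp
  set B : NNReal := ⟨Real.exp (l * T) * (l * r), by positivity⟩ with hB
  have hPL : IsPicardLindelof v (tmin := 0) (tmax := T) ⟨0, by simp [hT.le]⟩ (u₀ - c)
      (B * ⟨T, hT.le⟩) 0 B (⟨l, hl.le⟩ + K) := by
    constructor
    · intro t ht
      refine (LipschitzWith.of_dist_le_mul fun x y => ?_).lipschitzOnWith
      simp only [hv, dist_eq_norm, ← smul_sub, norm_smul, Real.norm_of_nonneg (Real.exp_pos _).le]
      have h := hHlip (c + Real.exp (-(l * t)) • x) (c + Real.exp (-(l * t)) • y)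
      rw [add_sub_add_left_eq_sub, ← smul_sub, norm_smul,
        Real.norm_of_nonneg (Real.exp_pos _).le] at h
      calc _ ≤ Real.exp (l * t) * ((l + K) * (Real.exp (-(l * t)) * ‖x - y‖)) := by gcongr
        _ = (Real.exp (l * t) * Real.exp (-(l * t))) * ((l + K) * ‖x - y‖) := by ring
        _ = _ := by rw [hee, one_mul]; rfl
    · intro x _
      apply Continuous.continuousOn
      simp only [hv]
      fun_prop
    · intro t ht x _
      refine (hvb t x).trans ?_
      change _ ≤ Real.exp (l * T) * (l * r)
      have := ht.2
      gcongr
    · simp only [sub_zero, sub_self, NNReal.coe_zero, max_eq_left hT.le]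
      exact le_refl _
  obtain ⟨w, hw0, hw⟩ := hPL.exists_eq_forall_mem_Icc_hasDerivWithinAt₀
  have hwc : ContinuousOn w (Icc 0 T) := fun t ht => (hw t ht).continuousWithinAt
  have hwb : ∀ ⦃t⦄, t ∈ Icc 0 T → ‖w t‖ ≤ Real.exp (l * t) * r := by
    refine image_norm_le_of_norm_deriv_right_le_deriv_boundary (f' := fun t => v t (w t))
      (B' := fun t => Real.exp (l * t) * (l * r)) hwc ?_ ?_ ?_ ?_
    · intro t ht
      exact (hw t ⟨ht.1, ht.2.le⟩).mono_of_mem_nhdsWithin (Icc_mem_nhdsGE_of_mem ht)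
    · have : w 0 = u₀ - c := hw0
      rw [this]
      simpa [dist_eq_norm] using hu₀
    · intro t
      have := (((hasDerivAt_id t).const_mul l).exp).mul_const r
      simp only [id, mul_one] at this
      exact this.congr_deriv (by ring)
    · intro t _
      exact hvb _ _
  have hub : ∀ t ∈ Icc 0 T, c + Real.exp (-(l * t)) • w t ∈ Metric.closedBall c r := by
    intro t ht
    rw [Metric.mem_closedBall, dist_eq_norm, add_sub_cancel_left, norm_smul,
      Real.norm_of_nonneg (Real.exp_pos _).le]
    calc _ ≤ Real.exp (-(l * t)) * (Real.exp (l * t) * r) := by gcongr; exact hwb ht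
      _ = (Real.exp (l * t) * Real.exp (-(l * t))) * r := by ring
      _ = r := by rw [hee, one_mul]
  refine ⟨fun t => c + Real.exp (-(l * t)) • w t, ?_, ?_⟩
  · have : w 0 = u₀ - c := hw0
    simp [this]
  · intro t ht
    have he : HasDerivAt (fun t => Real.exp (-(l * t))) (Real.exp (-(l * t)) * (-l)) t := by
      have := ((hasDerivAt_id t).const_mul l).neg.exp
      simpa using this
    have := (he.hasDerivWithinAt.smul (hw t ht)).const_add c
    refine this.congr_deriv ?_
    have hP' := hPid _ (hub t ht)
    simp only [hv, hH, hP']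
    rw [smul_smul (Real.exp (-(l * t))), mul_comm (Real.exp (-(l * t))) (Real.exp (l * t)), hee]
    module

instance mu01_finite : IsFiniteMeasure mu01 := by
  unfold mu01; infer_instance

theorem norm_le_of_ae (f : Lp ℝ ⊤ mu01) (C : ℝ) (hC : 0 ≤ C)
    (h : ∀ᵐ x ∂mu01, |(f : ℝ → ℝ) x| ≤ C) : ‖f‖ ≤ C := by
  rw [Lp.norm_def, eLpNorm_exponent_top]
  exact ENNReal.toReal_le_of_le_ofReal hC (eLpNormEssSup_le_of_ae_bound h)

theorem ae_le_norm (f : Lp ℝ ⊤ mu01) : ∀ᵐ x ∂mu01, |(f : ℝ → ℝ) x| ≤ ‖f‖ := by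
  have h := ae_le_eLpNormEssSup (f := (f : ℝ → ℝ)) (μ := mu01)
  have hf := Lp.eLpNorm_ne_top f
  rw [eLpNorm_exponent_top] at hf
  filter_upwards [h] with x hx
  rw [Lp.norm_def, eLpNorm_exponent_top]
  have := ENNReal.toReal_mono hf hx
  simpa using this

theorem lap_bounds (W : ℝ → ℝ → ℝ) (hW : IsGraphon W) (f : Lp ℝ ⊤ mu01) (M₁ M₂ : ℝ)
    (hf : ∀ᵐ x ∂mu01, (f : ℝ → ℝ) x ∈ Icc M₁ M₂) :
    ∀ᵐ x ∂mu01, M₁ - f x ≤ graphonLap W f x ∧ graphonLap W f x ≤ M₂ - f x := by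
  obtain ⟨hWm, -, hW0, hWi, hWd⟩ := hW
  filter_upwards [hWd, hWi.prod_right_ae, hf] with x hd hi hx
  simp only [Function.uncurry] at hi
  have hint : Integrable (fun y => W x y * (f y - f x)) mu01 := by
    refine hi.mul_bdd (c := ‖f‖ + |f x|)
      ((Lp.aestronglyMeasurable f).sub aestronglyMeasurable_const) ?_
    filter_upwards [ae_le_norm f] with y hy
    exact (norm_sub_le _ _).trans (add_le_add hy le_rfl)
  have h0 : 0 ≤ ∫ y, W x y ∂mu01 := integral_nonneg (hW0 x)
  unfold graphonLap
  constructor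
  · have : ∫ y, W x y * (M₁ - f x) ∂mu01 ≤ ∫ y, W x y * (f y - f x) ∂mu01 := by
      refine integral_mono_ae (hi.mul_const _) hint ?_
      filter_upwards [hf] with y hy
      exact mul_le_mul_of_nonneg_left (by linarith [hy.1]) (hW0 x y)
    rw [integral_mul_const] at this
    nlinarith [hx.1]
  · have : ∫ y, W x y * (f y - f x) ∂mu01 ≤ ∫ y, W x y * (M₂ - f x) ∂mu01 := by
      refine integral_mono_ae hint (hi.mul_const _) ?_
      filter_upwards [hf] with y hy
      exact mul_le_mul_of_nonneg_left (by linarith [hy.2]) (hW0 x y)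
    rw [integral_mul_const] at this
    nlinarith [hx.2]

theorem nem_lip (Φ : ℝ → ℝ) (NΦ : Lp ℝ ⊤ mu01 → Lp ℝ ⊤ mu01)
    (hNΦ : ∀ f : Lp ℝ ⊤ mu01, (NΦ f : ℝ → ℝ) =ᵐ[mu01] fun x => Φ ((f : ℝ → ℝ) x))
    (R : ℝ) (K : NNReal) (hK : LipschitzOnWith K Φ (Icc (-R) R)) :
    LipschitzOnWith K NΦ (Metric.closedBall 0 R) := by
  refine LipschitzOnWith.of_dist_le_mul fun f hf g hg => ?_
  rw [mem_closedBall_zero_iff] at hf hg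
  rw [dist_eq_norm, dist_eq_norm]
  refine norm_le_of_ae _ _ (by positivity) ?_
  filter_upwards [hNΦ f, hNΦ g, Lp.coeFn_sub (NΦ f) (NΦ g), Lp.coeFn_sub f g, ae_le_norm f,
    ae_le_norm g, ae_le_norm (f - g)] with x h1 h2 h3 h4 h5 h6 h7
  rw [h3, Pi.sub_apply, h1, h2]
  rw [h4, Pi.sub_apply] at h7
  have := hK.dist_le_mul _ (abs_le.1 (h5.trans hf)) _ (abs_le.1 (h6.trans hg))
  rw [Real.dist_eq, Real.dist_eq] at this
  exact this.trans (by gcongr)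

theorem clamp_lip (r : ℝ) : LipschitzWith 1 (fun x : ℝ => max (-r) (min r x)) :=
  (LipschitzWith.id.const_min r).const_max (-r)

theorem graphonRD_globalWellPosed_Linfty
    (W : ℝ → ℝ → ℝ) (hW : IsGraphon W)
    (Φ : ℝ → ℝ) (hΦ0 : Φ 0 = 0)
    (hΦlip : ∀ R : ℝ, 0 < R → ∃ K : NNReal, LipschitzOnWith K Φ (Icc (-R) R))
    (M₁ M₂ : ℝ) (hM : M₁ < M₂) (hΦM₂ : Φ M₂ ≤ 0) (hΦM₁ : 0 ≤ Φ M₁)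
    (L : Lp ℝ ⊤ mu01 →L[ℝ] Lp ℝ ⊤ mu01)
    (hL : ∀ f : Lp ℝ ⊤ mu01, (L f : ℝ → ℝ) =ᵐ[mu01] graphonLap W f)
    (NΦ : Lp ℝ ⊤ mu01 → Lp ℝ ⊤ mu01)
    (hNΦ : ∀ f : Lp ℝ ⊤ mu01, (NΦ f : ℝ → ℝ) =ᵐ[mu01] fun x => Φ ((f : ℝ → ℝ) x))
    (u₀ : Lp ℝ ⊤ mu01) (hinit : ∀ᵐ x ∂mu01, (u₀ : ℝ → ℝ) x ∈ Icc M₁ M₂)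
    (T : ℝ) (hT : 0 < T) :
    ∃ u : ℝ → Lp ℝ ⊤ mu01,
      u 0 = u₀ ∧
      (∀ t ∈ Icc (0:ℝ) T, HasDerivWithinAt u (L (u t) + NΦ (u t)) (Icc 0 T) t) ∧
      (∀ v : ℝ → Lp ℝ ⊤ mu01, v 0 = u₀ →
        (∀ t ∈ Icc (0:ℝ) T, HasDerivWithinAt v (L (v t) + NΦ (v t)) (Icc 0 T) t) →
        ∀ t ∈ Icc (0:ℝ) T, v t = u t) := by
  have hFlip : ∀ R : ℝ, 0 < R → ∃ K : NNReal,
      LipschitzOnWith K (fun f => L f + NΦ f) (Metric.closedBall 0 R) := by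
    intro R hR
    obtain ⟨K, hK⟩ := hΦlip R hR
    exact ⟨_, (L.lipschitz.lipschitzOnWith).add (nem_lip Φ NΦ hNΦ R K hK)⟩
  set m : ℝ := (M₁ + M₂) / 2 with hm
  set r : ℝ := (M₂ - M₁) / 2 with hr
  have hr0 : 0 < r := by rw [hr]; linarith
  set c : Lp ℝ ⊤ mu01 := Lp.const ⊤ mu01 m with hc
  have hcc : ∀ᵐ x ∂mu01, (c : ℝ → ℝ) x = m := Lp.coeFn_const ..
  have hball : ∀ f : Lp ℝ ⊤ mu01, f ∈ Metric.closedBall c r ↔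
      ∀ᵐ x ∂mu01, (f : ℝ → ℝ) x ∈ Icc M₁ M₂ := by
    intro f
    rw [Metric.mem_closedBall, dist_eq_norm]
    constructor
    · intro h
      filter_upwards [hcc, Lp.coeFn_sub f c, ae_le_norm (f - c)] with x h1 h2 h3
      rw [h2, Pi.sub_apply, h1] at h3
      have := abs_le.1 (h3.trans h)
      constructor <;> linarith [this.1, this.2]
    · intro h
      refine norm_le_of_ae _ _ hr0.le ?_
      filter_upwards [hcc, Lp.coeFn_sub f c, h] with x h1 h2 h3
      rw [h2, Pi.sub_apply, h1, abs_le]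
      constructor <;> linarith [h3.1, h3.2]
  set R : ℝ := |M₁| + |M₂| + 1 with hR
  have hR0 : 0 < R := by positivity
  have hIR : Icc M₁ M₂ ⊆ Icc (-R) R := by
    intro x hx
    constructor <;> linarith [hx.1, hx.2, neg_abs_le M₁, le_abs_self M₂, abs_nonneg M₁,
      abs_nonneg M₂]
  have hsub : Metric.closedBall c r ⊆ Metric.closedBall 0 R := by
    intro f hf
    rw [mem_closedBall_zero_iff]
    refine norm_le_of_ae _ _ hR0.le ?_
    filter_upwards [(hball f).1 hf] with x hx
    exact abs_le.2 (hIR hx)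
  obtain ⟨K, hK⟩ := hΦlip R hR0
  obtain ⟨K', hK'⟩ := hFlip R hR0
  have g0 : max (-r) (min r 0) = 0 := by
    rw [min_eq_right hr0.le, max_eq_right (by linarith)]
  set Q : Lp ℝ ⊤ mu01 → Lp ℝ ⊤ mu01 := (clamp_lip r).compLp g0 with hQ
  have hQc : ∀ f, ∀ᵐ x ∂mu01, (Q f : ℝ → ℝ) x = max (-r) (min r (f x)) := fun f =>
    (clamp_lip r).coeFn_compLp g0 f
  have hQl : LipschitzWith 1 Q := (clamp_lip r).lipschitzWith_compLp g0
  obtain ⟨u, hu0, hu⟩ := ode_ball (fun f => L f + NΦ f) (fun f => c + Q (f - c)) c r (1 + K)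
    hr0.le (by positivity) K'
    (by
      refine LipschitzWith.of_dist_le_mul fun f g => ?_
      have := hQl.dist_le_mul (f - c) (g - c)
      simpa only [dist_add_left, dist_sub_right] using this)
    (by
      intro f
      rw [Metric.mem_closedBall, dist_eq_norm, add_sub_cancel_left]
      refine norm_le_of_ae _ _ hr0.le ?_
      filter_upwards [hQc (f - c)] with x hx
      rw [hx, abs_le]
      exact ⟨le_max_left _ _, max_le (by linarith) (min_le_left _ _)⟩)
    (by
      intro f hf
      rw [Metric.mem_closedBall, dist_eq_norm] at hf
      suffices h : Q (f - c) = f - c by rw [h]; abel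
      apply Lp.ext
      filter_upwards [hQc (f - c), ae_le_norm (f - c)] with x hx h
      have := abs_le.1 (h.trans hf)
      rw [hx, min_eq_right this.2, max_eq_right this.1])
    (hK'.mono hsub)
    (by
      intro f hf
      have hf' := (hball f).1 hf
      refine norm_le_of_ae _ _ (by positivity) ?_
      filter_upwards [Lp.coeFn_add ((1 + (K:ℝ)) • (f - c)) (L f + NΦ f), Lp.coeFn_add (L f) (NΦ f),
        Lp.coeFn_smul (1 + (K:ℝ)) (f - c), Lp.coeFn_sub f c, hcc, hL f, hNΦ f, hf',
        lap_bounds W hW f M₁ M₂ hf'] with x h1 h2 h3 h4 h5 h6 h7 h8 h9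
      rw [h1, Pi.add_apply, h2, Pi.add_apply, h3, Pi.smul_apply, h4, Pi.sub_apply, h5, h6, h7,
        smul_eq_mul]
      have e1 := hK.dist_le_mul _ (hIR h8) _ (hIR (left_mem_Icc.2 hM.le))
      have e2 := hK.dist_le_mul _ (hIR h8) _ (hIR (right_mem_Icc.2 hM.le))
      rw [Real.dist_eq, Real.dist_eq, abs_of_nonneg (sub_nonneg.2 h8.1)] at e1
      rw [Real.dist_eq, Real.dist_eq, abs_of_nonpos (sub_nonpos.2 h8.2)] at e2
      have e1' := (abs_le.1 e1).1
      have e2' := (abs_le.1 e2).2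
      rw [abs_le]
      constructor
      · have : (1 + (K:ℝ)) * (f x - m) = (1 + K) * (f x - M₁) - (1 + K) * r := by
          rw [hm, hr]; ring
        rw [this]
        linarith [h9.1]
      · have : (1 + (K:ℝ)) * (f x - m) = (1 + K) * r - (1 + K) * (M₂ - f x) := by
          rw [hm, hr]; ring
        rw [this]
        linarith [h9.2])
    u₀ ((hball u₀).2 hinit) T hT
  refine ⟨u, hu0, hu, ?_⟩
  intro v hv0 hv
  have huc : ContinuousOn u (Icc 0 T) := fun t ht => (hu t ht).continuousWithinAt
  have hvc : ContinuousOn v (Icc 0 T) := fun t ht => (hv t ht).continuousWithinAt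
  obtain ⟨A, hA⟩ := isCompact_Icc.exists_bound_of_continuousOn huc
  obtain ⟨B, hB⟩ := isCompact_Icc.exists_bound_of_continuousOn hvc
  obtain ⟨K₂, hK₂⟩ := hFlip (|A| + |B| + 1) (by positivity)
  refine ODE_solution_unique_of_mem_Icc_right (K := K₂) (v := fun _ f => L f + NΦ f)
    (s := fun _ => Metric.closedBall 0 (|A| + |B| + 1)) (fun t _ => hK₂) hvc ?_ ?_ huc ?_ ?_
    (hv0.trans hu0.symm)
  · intro t ht
    exact (hv t ⟨ht.1, ht.2.le⟩).mono_of_mem_nhdsWithin (Icc_mem_nhdsGE_of_mem ht)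
  · intro t ht
    rw [mem_closedBall_zero_iff]
    linarith [hB t ⟨ht.1, ht.2.le⟩, le_abs_self B, abs_nonneg A]
  · intro t ht
    exact (hu t ⟨ht.1, ht.2.le⟩).mono_of_mem_nhdsWithin (Icc_mem_nhdsGE_of_mem ht)
  · intro t ht
    rw [mem_closedBall_zero_iff]
    linarith [hA t ⟨ht.1, ht.2.le⟩, le_abs_self A, abs_nonneg B]
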